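/- arXiv:2507.21292 — 2 statements merged into one kernel-verified Lean document; each statement's English description precedes it below -/
import Mathlib

section
/- Let T ∈ R(V). Then T is Weyl-type (T ∈ W(V)) if and only if the following three conditions hold: T^{∥u} ∈ W(V), the trace γ^{αβ} T^{⊥∥}_{αβμ} vanishes, and tr_γ T^⊥ = 0. -/
open scoped BigOperators

noncomputable section

namespace Decomp

abbrev Vec (n : ℕ) := Fin n → ℝ
abbrev Ten2 (n : ℕ) := Fin n → Fin n → ℝ
abbrev Ten3 (n : ℕ) := Fin n → Fin n → Fin n → ℝ
abbrev Ten4 (n : ℕ) := Fin n → Fin n → Fin n → Fin n → ℝ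

variable {n : ℕ}

/-- A (0,4)-tensor with the algebraic symmetries of a Riemann tensor. -/
def IsRiemannType (T : Ten4 n) : Prop :=
  (∀ α β μ ν, T α β μ ν = - T α β ν μ) ∧
  (∀ α β μ ν, T α β μ ν = - T β α μ ν) ∧
  (∀ α β μ ν, T α β μ ν = T μ ν α β) ∧
  (∀ α β μ ν, T α β μ ν + T α μ ν β + T α ν β μ = 0)

/-- A (0,3)-tensor antisymmetric in the last two indices with vanishing cyclic sum. -/
def IsLambda12 (F : Ten3 n) : Prop :=
  (∀ α μ ν, F α μ ν = - F α ν μ) ∧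
  (∀ α μ ν, F α μ ν + F μ ν α + F ν α μ = 0)

def IsSym2 (S : Ten2 n) : Prop := ∀ α β, S α β = S β α

/-- Ricci-type trace of a (0,4)-tensor (first and third indices, using the inverse metric). -/
def RicT (ginv : Ten2 n) (T : Ten4 n) : Ten2 n :=
  fun β ν => ∑ α, ∑ μ, ginv α μ * T α β μ ν

/-- Scalar-type trace. -/
def ScalT (ginv : Ten2 n) (T : Ten4 n) : ℝ :=
  ∑ β, ∑ ν, ginv β ν * RicT ginv T β ν

/-- Weyl-type: Riemann-type and trace-free in the first and third indices. -/
def IsWeylType (ginv : Ten2 n) (T : Ten4 n) : Prop :=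
  IsRiemannType T ∧ ∀ β ν, RicT ginv T β ν = 0

/-- Kulkarni–Nomizu product. -/
def KN (A B : Ten2 n) : Ten4 n := fun α β μ ν =>
  A α μ * B β ν - A α ν * B β μ - A β μ * B α ν + A β ν * B α μ

/-- (u ⊛ F) for a one-form w and F ∈ Λ^{(1,2)}. -/
def circ (w : Vec n) (F : Ten3 n) : Ten4 n := fun α β μ ν =>
  w α * F β μ ν - w β * F α μ ν + w μ * F ν α β - w ν * F μ α β

/-- Lower an index with the metric. -/
def lower (g : Ten2 n) (u : Vec n) : Vec n := fun α => ∑ β, g α β * u β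

/-- Projector orthogonal to `u`, both indices covariant: γ_{αβ} = g_{αβ} − ε u_α u_β. -/
def gam (g : Ten2 n) (ε : ℝ) (u : Vec n) : Ten2 n := fun α β =>
  g α β - ε * lower g u α * lower g u β

/-- Mixed projector γ^κ_μ = δ^κ_μ − ε u^κ u_μ. -/
def gamMix (g : Ten2 n) (ε : ℝ) (u : Vec n) : Ten2 n := fun κ μ =>
  (if κ = μ then (1 : ℝ) else 0) - ε * u κ * lower g u μ

/-- Contravariant projector γ^{αβ} = g^{αβ} − ε u^α u^β. -/
def gamUp (ginv : Ten2 n) (ε : ℝ) (u : Vec n) : Ten2 n := fun α β =>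
  ginv α β - ε * u α * u β

/-- η := u⊗u − (ε/(n−3)) γ. -/
def eta (g : Ten2 n) (ε : ℝ) (u : Vec n) : Ten2 n := fun α β =>
  lower g u α * lower g u β - (ε / ((n : ℝ) - 3)) * gam g ε u α β

/-- T^⊥_{βν} := u^α u^μ T_{αβμν}. -/
def perp (u : Vec n) (T : Ten4 n) : Ten2 n := fun β ν =>
  ∑ α, ∑ μ, u α * u μ * T α β μ ν

/-- T^{⊥∥}_{βμν} := u^α γ^κ_μ γ^σ_ν T_{αβκσ}. -/
def perppar (g : Ten2 n) (ε : ℝ) (u : Vec n) (T : Ten4 n) : Ten3 n := fun β μ ν =>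
  ∑ α, ∑ κ, ∑ σ, u α * gamMix g ε u κ μ * gamMix g ε u σ ν * T α β κ σ

/-- T^∥ : projection of T with γ in all four indices. -/
def par4 (g : Ten2 n) (ε : ℝ) (u : Vec n) (T : Ten4 n) : Ten4 n := fun α β μ ν =>
  ∑ ρ, ∑ σ, ∑ κ, ∑ δ,
    gamMix g ε u ρ α * gamMix g ε u σ β * gamMix g ε u κ μ * gamMix g ε u δ ν * T ρ σ κ δ

/-- T^{∥u} := T^∥ + (ε/(n−3)) T^⊥ ∧ γ. -/
def parU (g : Ten2 n) (ε : ℝ) (u : Vec n) (T : Ten4 n) : Ten4 n := fun α β μ ν =>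
  par4 g ε u T α β μ ν + (ε / ((n : ℝ) - 3)) * KN (perp u T) (gam g ε u) α β μ ν

/-- Complete orthogonality to `u` for (0,2)-tensors. -/
def Orth2 (u : Vec n) (S : Ten2 n) : Prop :=
  (∀ β, (∑ α, u α * S α β) = 0) ∧ (∀ β, (∑ α, u α * S β α) = 0)

/-- Complete orthogonality to `u` for (0,3)-tensors. -/
def Orth3 (u : Vec n) (F : Ten3 n) : Prop :=
  (∀ μ ν, (∑ α, u α * F α μ ν) = 0) ∧ (∀ μ ν, (∑ α, u α * F μ α ν) = 0) ∧
    (∀ μ ν, (∑ α, u α * F μ ν α) = 0)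

/-- Complete orthogonality to `u` for (0,4)-tensors. -/
def Orth4 (u : Vec n) (T : Ten4 n) : Prop :=
  (∀ β μ ν, (∑ α, u α * T α β μ ν) = 0) ∧ (∀ β μ ν, (∑ α, u α * T β α μ ν) = 0) ∧
    (∀ β μ ν, (∑ α, u α * T β μ α ν) = 0) ∧ (∀ β μ ν, (∑ α, u α * T β μ ν α) = 0)

/-- tr_γ of a (0,2)-tensor. -/
def trGam (ginv : Ten2 n) (ε : ℝ) (u : Vec n) (S : Ten2 n) : ℝ :=
  ∑ α, ∑ β, gamUp ginv ε u α β * S α β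

/-- Schouten-type tensor of a (0,4)-tensor. -/
def SchT (g ginv : Ten2 n) (T : Ten4 n) : Ten2 n := fun β ν =>
  (1 / ((n : ℝ) - 2)) * (RicT ginv T β ν - ScalT ginv T / (2 * ((n : ℝ) - 1)) * g β ν)

/-- Weyl-type part of a (0,4)-tensor: Weyl(T) := T − Sch(T) ∧ g. -/
def WeylT (g ginv : Ten2 n) (T : Ten4 n) : Ten4 n := fun α β μ ν =>
  T α β μ ν - KN (SchT g ginv T) g α β μ ν

/-- Sch_u for Riemann-type tensors completely orthogonal to u. -/
def SchU (g ginv : Ten2 n) (ε : ℝ) (u : Vec n) (P : Ten4 n) : Ten2 n := fun β ν =>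
  (1 / ((n : ℝ) - 3)) * (RicT ginv P β ν - ScalT ginv P / (2 * ((n : ℝ) - 2)) * gam g ε u β ν)

/-- Weyl_u for Riemann-type tensors completely orthogonal to u. -/
def WeylU (g ginv : Ten2 n) (ε : ℝ) (u : Vec n) (P : Ten4 n) : Ten4 n := fun α β μ ν =>
  P α β μ ν - KN (SchU g ginv ε u P) (gam g ε u) α β μ ν

/-- Z_tr := tr_γ T^⊥. -/
def Ztr (ginv : Ten2 n) (ε : ℝ) (u : Vec n) (T : Ten4 n) : ℝ :=
  trGam ginv ε u (perp u T)

/-- γ-trace-free part of an orthogonal symmetric (0,2)-tensor. -/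
def hat2 (g ginv : Ten2 n) (ε : ℝ) (u : Vec n) (S : Ten2 n) : Ten2 n := fun β ν =>
  S β ν - trGam ginv ε u S / ((n : ℝ) - 1) * gam g ε u β ν

/-- T̂^⊥ := T^⊥ − (Z_tr/(n−1)) γ. -/
def hatPerp (g ginv : Ten2 n) (ε : ℝ) (u : Vec n) (T : Ten4 n) : Ten2 n :=
  hat2 g ginv ε u (perp u T)

/-- (V_tr)_μ := γ^{αβ} T^{⊥∥}_{αβμ}. -/
def Vtr (g ginv : Ten2 n) (ε : ℝ) (u : Vec n) (T : Ten4 n) : Vec n := fun μ =>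
  ∑ α, ∑ β, gamUp ginv ε u α β * perppar g ε u T α β μ

/-- T̂^{⊥∥}_{αβμ} := T^{⊥∥}_{αβμ} + (1/(n−2))(−γ_{αβ}(V_tr)_μ + γ_{αμ}(V_tr)_β). -/
def hatPerppar (g ginv : Ten2 n) (ε : ℝ) (u : Vec n) (T : Ten4 n) : Ten3 n := fun α β μ =>
  perppar g ε u T α β μ + (1 / ((n : ℝ) - 2)) *
    (- gam g ε u α β * Vtr g ginv ε u T μ + gam g ε u α μ * Vtr g ginv ε u T β)

/-- S^∥_{βν} := γ^ρ_β γ^κ_ν S_{ρκ}. -/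
def s2par (g : Ten2 n) (ε : ℝ) (u : Vec n) (S : Ten2 n) : Ten2 n := fun β ν =>
  ∑ ρ, ∑ κ, gamMix g ε u ρ β * gamMix g ε u κ ν * S ρ κ

/-- S^{⊥∥}_β := γ^ρ_β u^κ S_{ρκ}. -/
def s2perppar (g : Ten2 n) (ε : ℝ) (u : Vec n) (S : Ten2 n) : Vec n := fun β =>
  ∑ ρ, ∑ κ, gamMix g ε u ρ β * u κ * S ρ κ

/-- S^⊥ := u^ρ u^κ S_{ρκ}. -/
def s2perp (u : Vec n) (S : Ten2 n) : ℝ := ∑ ρ, ∑ κ, u ρ * u κ * S ρ κ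

/-- σ^{(2)}_{βν} := σ_{βρ} σ^ρ{}_ν. -/
def sq (ginv : Ten2 n) (σ : Ten2 n) : Ten2 n := fun β ν =>
  ∑ ρ, ∑ κ, σ β ρ * ginv ρ κ * σ κ ν

/-- Mixed projector h^μ_{μ'} = γ^μ_{μ'} + ε y^μ y_{μ'} orthogonal to span{u,y}. -/
def hMix (g : Ten2 n) (ε : ℝ) (u y : Vec n) : Ten2 n := fun μ μ' =>
  gamMix g ε u μ μ' + ε * y μ * lower g y μ'

/-- Covariant projector h_{αβ} = γ_{αβ} + ε y_α y_β. -/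
def hCov (g : Ten2 n) (ε : ℝ) (u y : Vec n) : Ten2 n := fun α β =>
  gam g ε u α β + ε * lower g y α * lower g y β

/-- g is a symmetric nondegenerate bilinear form with (symmetric) inverse ginv. -/
def GoodMetric (g ginv : Ten2 n) : Prop :=
  (∀ α β, g α β = g β α) ∧ (∀ α β, ginv α β = ginv β α) ∧
    (∀ α β, (∑ μ, ginv α μ * g μ β) = if α = β then (1 : ℝ) else 0) ∧
    (∀ α β, (∑ μ, g α μ * ginv μ β) = if α = β then (1 : ℝ) else 0)

/-- u is a unit vector with g(u,u) = ε ∈ {−1,1}. -/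
def UnitVec (g : Ten2 n) (ε : ℝ) (u : Vec n) : Prop :=
  (ε = 1 ∨ ε = -1) ∧ (∑ α, ∑ β, g α β * u α * u β) = ε


/-- The value `S(a, b)` of a (0,2)-tensor on two vectors. -/
def bil (S : Ten2 n) (a b : Vec n) : ℝ := ∑ i, ∑ j, a i * b j * S i j

/-- The value `T(a, b, c, d)` of a (0,4)-tensor on four vectors. -/
def quad (T : Ten4 n) (a b c d : Vec n) : ℝ :=
  ∑ ρ, ∑ σ, ∑ κ, ∑ δ, a ρ * b σ * c κ * d δ * T ρ σ κ δ

/-- The trace of a (0,2)-tensor with respect to `h`. -/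
def tr2 (h S : Ten2 n) : ℝ := ∑ α, ∑ μ, h α μ * S α μ

lemma bil_sub_smul_left (S : Ten2 n) (a a' b : Vec n) (c : ℝ) :
    bil S (a - c • a') b = bil S a b - c * bil S a' b := by
  simp only [bil, Finset.mul_sum, ← Finset.sum_sub_distrib, Pi.sub_apply, Pi.smul_apply,
    smul_eq_mul]
  exact Finset.sum_congr rfl fun i _ => Finset.sum_congr rfl fun j _ => by ring

lemma bil_sub_smul_right (S : Ten2 n) (a b b' : Vec n) (c : ℝ) :
    bil S a (b - c • b') = bil S a b - c * bil S a b' := by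
  simp only [bil, Finset.mul_sum, ← Finset.sum_sub_distrib, Pi.sub_apply, Pi.smul_apply,
    smul_eq_mul]
  exact Finset.sum_congr rfl fun i _ => Finset.sum_congr rfl fun j _ => by ring

lemma bil_single_right (S : Ten2 n) (a : Vec n) (j : Fin n) :
    bil S a (Pi.single j 1) = ∑ i, a i * S i j := by
  simp [bil, Pi.single_apply]

lemma bil_single_left (S : Ten2 n) (b : Vec n) (i : Fin n) :
    bil S (Pi.single i 1) b = ∑ j, b j * S i j := by
  simp [bil, Pi.single_apply]

lemma bil_single_single (S : Ten2 n) (i j : Fin n) :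
    bil S (Pi.single i 1) (Pi.single j 1) = S i j := by
  simp [bil_single_right, Pi.single_apply]

lemma bil_comm (S : Ten2 n) (hS : IsSym2 S) (a b : Vec n) : bil S a b = bil S b a := by
  unfold bil
  rw [Finset.sum_comm]
  exact Finset.sum_congr rfl fun i _ => Finset.sum_congr rfl fun j _ => by rw [hS j i]; ring

lemma sum_pair_comm (f : Fin n → Fin n → Fin n → Fin n → ℝ) :
    ∑ a, ∑ b, ∑ c, ∑ d, f a b c d = ∑ c, ∑ d, ∑ a, ∑ b, f a b c d := by
  rw [Finset.sum_congr rfl fun a _ => Finset.sum_comm, Finset.sum_comm]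
  refine Finset.sum_congr rfl fun c _ => ?_
  rw [Finset.sum_congr rfl fun a _ => Finset.sum_comm, Finset.sum_comm]

lemma quad_eq_bil (T : Ten4 n) (a b c d : Vec n) :
    quad T a b c d = bil (fun ρ κ => bil (fun σ δ => T ρ σ κ δ) b d) a c := by
  simp only [quad, bil, Finset.mul_sum]
  refine Finset.sum_congr rfl fun ρ _ => ?_
  rw [Finset.sum_comm]
  exact Finset.sum_congr rfl fun κ _ => Finset.sum_congr rfl fun σ _ =>
    Finset.sum_congr rfl fun δ _ => by ring

lemma bil_bil_comm (T : Ten4 n) (a b c d : Vec n) :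
    bil (fun ρ κ => bil (fun σ δ => T ρ σ κ δ) b d) a c =
      bil (fun σ δ => bil (fun ρ κ => T ρ σ κ δ) a c) b d := by
  simp only [bil, Finset.mul_sum]
  rw [sum_pair_comm]
  exact Finset.sum_congr rfl fun κ _ => Finset.sum_congr rfl fun σ _ =>
    Finset.sum_congr rfl fun δ _ => Finset.sum_congr rfl fun ρ _ => by ring

lemma tr2_bil (h : Ten2 n) (T : Ten4 n) (b d : Vec n) :
    tr2 h (fun ρ κ => bil (fun σ δ => T ρ σ κ δ) b d) = bil (RicT h T) b d := by
  simp only [tr2, bil, RicT, Finset.mul_sum]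
  rw [sum_pair_comm]
  exact Finset.sum_congr rfl fun κ _ => Finset.sum_congr rfl fun σ _ =>
    Finset.sum_congr rfl fun δ _ => Finset.sum_congr rfl fun ρ _ => by ring

section RiemannType

variable {T : Ten4 n}

lemma IsRiemannType.quad_swap_right (hT : IsRiemannType T) (a b c d : Vec n) :
    quad T a b c d = - quad T a b d c := by
  simp only [quad, ← Finset.sum_neg_distrib]
  refine Finset.sum_congr rfl fun ρ _ => Finset.sum_congr rfl fun σ _ => ?_
  rw [Finset.sum_comm]
  exact Finset.sum_congr rfl fun κ _ => Finset.sum_congr rfl fun δ _ => by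
    rw [hT.1 ρ σ δ κ]; ring

lemma IsRiemannType.quad_swap_left (hT : IsRiemannType T) (a b c d : Vec n) :
    quad T a b c d = - quad T b a c d := by
  simp only [quad, ← Finset.sum_neg_distrib]
  rw [Finset.sum_comm]
  exact Finset.sum_congr rfl fun ρ _ => Finset.sum_congr rfl fun σ _ =>
    Finset.sum_congr rfl fun κ _ => Finset.sum_congr rfl fun δ _ => by
      rw [hT.2.1 σ ρ κ δ]; ring

lemma IsRiemannType.quad_pair_comm (hT : IsRiemannType T) (a b c d : Vec n) :
    quad T a b c d = quad T c d a b := by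
  simp only [quad]
  rw [sum_pair_comm]
  exact Finset.sum_congr rfl fun ρ _ => Finset.sum_congr rfl fun σ _ =>
    Finset.sum_congr rfl fun κ _ => Finset.sum_congr rfl fun δ _ => by
      rw [hT.2.2.1 κ δ ρ σ]; ring

lemma sum_rotate (f : Fin n → Fin n → Fin n → ℝ) :
    ∑ σ, ∑ κ, ∑ δ, f σ κ δ = ∑ κ, ∑ δ, ∑ σ, f σ κ δ := by
  rw [Finset.sum_comm]
  exact Finset.sum_congr rfl fun κ _ => Finset.sum_comm

lemma IsRiemannType.quad_cyclic (hT : IsRiemannType T) (a b c d : Vec n) :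
    quad T a b c d + quad T a c d b + quad T a d b c = 0 := by
  simp only [quad]
  rw [← Finset.sum_add_distrib, ← Finset.sum_add_distrib]
  refine Finset.sum_eq_zero fun ρ _ => ?_
  rw [sum_rotate fun σ κ δ => a ρ * d σ * b κ * c δ * T ρ σ κ δ,
    ← sum_rotate fun σ κ δ => a ρ * c κ * d δ * b σ * T ρ κ δ σ]
  simp only [← Finset.sum_add_distrib]
  refine Finset.sum_eq_zero fun σ _ => Finset.sum_eq_zero fun κ _ =>
    Finset.sum_eq_zero fun δ _ => ?_
  linear_combination a ρ * b σ * c κ * d δ * hT.2.2.2 ρ σ κ δ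

lemma IsRiemannType.isSym2_perp (hT : IsRiemannType T) (u : Vec n) : IsSym2 (perp u T) := by
  intro β ν
  simp only [perp]
  rw [Finset.sum_comm]
  exact Finset.sum_congr rfl fun κ _ => Finset.sum_congr rfl fun σ _ => by
    rw [hT.2.2.1 σ β κ ν]; ring

lemma IsRiemannType.isSym2_ricT (hT : IsRiemannType T) {ginv : Ten2 n} (hg : IsSym2 ginv) :
    IsSym2 (RicT ginv T) := by
  intro β ν
  simp only [RicT]
  rw [Finset.sum_comm]
  exact Finset.sum_congr rfl fun κ _ => Finset.sum_congr rfl fun σ _ => by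
    rw [hT.2.2.1 σ β κ ν, hg σ κ]

lemma IsRiemannType.sum_perp (hT : IsRiemannType T) (u : Vec n) (ν : Fin n) :
    ∑ β, u β * perp u T β ν = 0 := by
  have h : ∑ β, u β * perp u T β ν = quad T u u u (Pi.single ν 1) := by
    rw [quad_eq_bil, bil_bil_comm, bil_single_right]
    rfl
  linarith [hT.quad_swap_left u u u (Pi.single ν 1)]

lemma IsRiemannType.tr2_perp (hT : IsRiemannType T) (ginv : Ten2 n) (u : Vec n) :
    tr2 ginv (perp u T) = bil (RicT ginv T) u u := by
  rw [← tr2_bil]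
  unfold tr2
  refine Finset.sum_congr rfl fun β _ => Finset.sum_congr rfl fun ν _ => ?_
  congr 1
  exact Finset.sum_congr rfl fun κ _ => Finset.sum_congr rfl fun σ _ => by
    rw [hT.1, hT.2.1]; ring

lemma isRiemannType_kn {A B : Ten2 n} (hA : IsSym2 A) (hB : IsSym2 B) :
    IsRiemannType (KN A B) := by
  refine ⟨fun α β μ ν => ?_, fun α β μ ν => ?_, fun α β μ ν => ?_, fun α β μ ν => ?_⟩ <;>
    simp only [KN]
  · ring
  · ring
  · rw [hA μ α, hA ν α, hA μ β, hA ν β, hB μ α, hB ν α, hB μ β, hB ν β]; ring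
  · rw [hA μ β, hA ν β, hA ν μ, hB μ β, hB ν β, hB ν μ]; ring

lemma IsRiemannType.add_const_mul {S : Ten4 n} (hT : IsRiemannType T) (hS : IsRiemannType S)
    (c : ℝ) : IsRiemannType fun α β μ ν => T α β μ ν + c * S α β μ ν := by
  refine ⟨fun α β μ ν => ?_, fun α β μ ν => ?_, fun α β μ ν => ?_, fun α β μ ν => ?_⟩
  · linear_combination hT.1 α β μ ν + c * hS.1 α β μ ν
  · linear_combination hT.2.1 α β μ ν + c * hS.2.1 α β μ ν
  · linear_combination hT.2.2.1 α β μ ν + c * hS.2.2.1 α β μ ν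
  · linear_combination hT.2.2.2 α β μ ν + c * hS.2.2.2 α β μ ν

lemma IsRiemannType.par4 (hT : IsRiemannType T) (g : Ten2 n) (ε : ℝ) (u : Vec n) :
    IsRiemannType (par4 g ε u T) :=
  ⟨fun _ _ _ _ => hT.quad_swap_right _ _ _ _, fun _ _ _ _ => hT.quad_swap_left _ _ _ _,
    fun _ _ _ _ => hT.quad_pair_comm _ _ _ _, fun _ _ _ _ => hT.quad_cyclic _ _ _ _⟩

lemma isSym2_gam {g : Ten2 n} (hg : IsSym2 g) (ε : ℝ) (u : Vec n) : IsSym2 (gam g ε u) := by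
  intro α β
  simp only [gam]
  rw [hg α β]; ring

lemma IsRiemannType.parU (hT : IsRiemannType T) {g : Ten2 n} (hg : IsSym2 g) (ε : ℝ)
    (u : Vec n) : IsRiemannType (parU g ε u T) :=
  (hT.par4 g ε u).add_const_mul (isRiemannType_kn (hT.isSym2_perp u) (isSym2_gam hg ε u)) _

end RiemannType

lemma gamMix_eq (g : Ten2 n) (ε : ℝ) (u : Vec n) (μ : Fin n) :
    (fun κ => gamMix g ε u κ μ) = Pi.single μ 1 - (ε * lower g u μ) • u := by
  ext κ
  simp only [gamMix, Pi.single_apply, Pi.sub_apply, Pi.smul_apply, smul_eq_mul]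
  ring

section Metric

variable {g ginv : Ten2 n} {ε : ℝ} {u : Vec n}

lemma UnitVec.sq_eq_one (hu : UnitVec g ε u) : ε * ε = 1 := by
  rcases hu.1 with rfl | rfl <;> norm_num

lemma UnitVec.sum_mul_lower (hu : UnitVec g ε u) : ∑ α, u α * lower g u α = ε := by
  rw [← hu.2]
  simp only [lower, Finset.mul_sum]
  exact Finset.sum_congr rfl fun κ _ => Finset.sum_congr rfl fun σ _ => by ring

lemma GoodMetric.sum_ginv_mul_lower (hg : GoodMetric g ginv) (u : Vec n) (α : Fin n) :
    ∑ μ, ginv α μ * lower g u μ = u α := by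
  simp only [lower, Finset.mul_sum]
  rw [Finset.sum_comm]
  have h : ∀ β, ∑ μ, ginv α μ * (g μ β * u β) = (if α = β then 1 else 0) * u β := by
    intro β
    rw [← hg.2.2.1 α β, Finset.sum_mul]
    exact Finset.sum_congr rfl fun _ _ => by ring
  simp [h]

lemma GoodMetric.sum_ginv_mul_gam (hg : GoodMetric g ginv) (ε : ℝ) (u : Vec n) (α β : Fin n) :
    ∑ μ, ginv α μ * gam g ε u μ β = gamMix g ε u α β := by
  have h : ∀ μ, ginv α μ * gam g ε u μ β =
      ginv α μ * g μ β - (ginv α μ * lower g u μ) * (ε * lower g u β) := by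
    intro μ; simp only [gam]; ring
  simp only [h, Finset.sum_sub_distrib, ← Finset.sum_mul, hg.2.2.1, hg.sum_ginv_mul_lower,
    gamMix]
  ring

lemma tr2_mul_lower_right (hg : GoodMetric g ginv) (u f : Vec n) :
    tr2 ginv (fun α μ => f α * lower g u μ) = ∑ α, u α * f α := by
  simp only [tr2]
  refine Finset.sum_congr rfl fun α _ => ?_
  rw [← hg.sum_ginv_mul_lower u α, Finset.sum_mul]
  exact Finset.sum_congr rfl fun _ _ => by ring

lemma tr2_swap (hg : IsSym2 ginv) (S : Ten2 n) :
    tr2 ginv (fun α μ => S μ α) = tr2 ginv S := by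
  simp only [tr2]
  rw [Finset.sum_comm]
  exact Finset.sum_congr rfl fun κ _ => Finset.sum_congr rfl fun σ _ => by rw [hg κ σ]

lemma tr2_mul_lower_left (hg : GoodMetric g ginv) (u f : Vec n) :
    tr2 ginv (fun α μ => lower g u α * f μ) = ∑ α, u α * f α := by
  rw [← tr2_mul_lower_right hg, ← tr2_swap hg.2.1]
  simp only [mul_comm]

lemma tr2_add (h S S' : Ten2 n) :
    tr2 h (fun α μ => S α μ + S' α μ) = tr2 h S + tr2 h S' := by
  simp only [tr2, mul_add, Finset.sum_add_distrib]

lemma tr2_sub (h S S' : Ten2 n) :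
    tr2 h (fun α μ => S α μ - S' α μ) = tr2 h S - tr2 h S' := by
  simp only [tr2, mul_sub, Finset.sum_sub_distrib]

lemma tr2_const_mul (h S : Ten2 n) (c : ℝ) :
    tr2 h (fun α μ => c * S α μ) = c * tr2 h S := by
  simp only [tr2, Finset.mul_sum]
  exact Finset.sum_congr rfl fun κ _ => Finset.sum_congr rfl fun σ _ => by ring

lemma tr2_gamUp (S : Ten2 n) : tr2 (gamUp ginv ε u) S = tr2 ginv S - ε * bil S u u := by
  simp only [tr2, bil, gamUp, Finset.mul_sum, ← Finset.sum_sub_distrib]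
  exact Finset.sum_congr rfl fun κ _ => Finset.sum_congr rfl fun σ _ => by ring

lemma tr2_bil_gamMix (hg : GoodMetric g ginv) (hu : UnitVec g ε u) (S : Ten2 n) :
    tr2 ginv (fun α μ => bil S (fun κ => gamMix g ε u κ α) (fun κ => gamMix g ε u κ μ)) =
      tr2 ginv S - ε * bil S u u := by
  have h : (fun α μ => bil S (fun κ => gamMix g ε u κ α) (fun κ => gamMix g ε u κ μ)) =
      fun α μ => (S α μ - ε * (bil S (Pi.single α 1) u * lower g u μ)) -
        ε * (lower g u α * (bil S u (Pi.single μ 1) - ε * bil S u u * lower g u μ)) := by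
    ext α μ
    simp only [gamMix_eq, bil_sub_smul_left, bil_sub_smul_right, bil_single_single]
    ring
  have h₁ : ∑ α, u α * bil S (Pi.single α 1) u = bil S u u := by
    simp only [bil_single_left, Finset.mul_sum]
    exact Finset.sum_congr rfl fun κ _ => Finset.sum_congr rfl fun σ _ => by ring
  have h₂ : ∑ α, u α * (bil S u (Pi.single α 1) - ε * bil S u u * lower g u α) = 0 := by
    have : ∑ α, u α * bil S u (Pi.single α 1) = bil S u u := by
      simp only [bil_single_right, Finset.mul_sum]
      rw [Finset.sum_comm]
      exact Finset.sum_congr rfl fun κ _ => Finset.sum_congr rfl fun σ _ => by ring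
    have h₃ : ∀ α, u α * (bil S u (Pi.single α 1) - ε * bil S u u * lower g u α) =
        u α * bil S u (Pi.single α 1) - ε * bil S u u * (u α * lower g u α) := by
      intro α; ring
    simp only [h₃, Finset.sum_sub_distrib, ← Finset.mul_sum, this, hu.sum_mul_lower]
    linear_combination - bil S u u * hu.sq_eq_one
  rw [h, tr2_sub, tr2_sub, tr2_const_mul, tr2_const_mul, tr2_mul_lower_right hg,
    tr2_mul_lower_left hg, h₁, h₂]
  ring

lemma bil_gamMix_of_orth {S : Ten2 n} (hS : IsSym2 S) (h : ∀ ν, ∑ β, u β * S β ν = 0)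
    (β ν : Fin n) :
    bil S (fun κ => gamMix g ε u κ β) (fun κ => gamMix g ε u κ ν) = S β ν := by
  have hr : ∀ ν, bil S u (Pi.single ν 1) = 0 := fun ν => by rw [bil_single_right, h]
  have huu : bil S u u = 0 := by
    unfold bil
    rw [Finset.sum_comm]
    refine Finset.sum_eq_zero fun j _ => ?_
    calc ∑ i, u i * u j * S i j = u j * ∑ i, u i * S i j := by
          rw [Finset.mul_sum]; exact Finset.sum_congr rfl fun _ _ => by ring
      _ = 0 := by rw [h, mul_zero]
  simp only [gamMix_eq, bil_sub_smul_left, bil_sub_smul_right, bil_single_single, hr, huu,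
    bil_comm S hS (Pi.single β 1) u]
  ring

lemma ricT_par4 (hg : GoodMetric g ginv) (hu : UnitVec g ε u) {T : Ten4 n}
    (hT : IsRiemannType T) (β ν : Fin n) :
    RicT ginv (par4 g ε u T) β ν =
      bil (RicT ginv T) (fun κ => gamMix g ε u κ β) (fun κ => gamMix g ε u κ ν) -
        ε * perp u T β ν := by
  rw [← bil_gamMix_of_orth (g := g) (ε := ε) (hT.isSym2_perp u) (hT.sum_perp u) β ν, ← tr2_bil]
  have h : bil (perp u T) (fun κ => gamMix g ε u κ β) (fun κ => gamMix g ε u κ ν) =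
      bil (fun ρ κ => bil (fun σ δ => T ρ σ κ δ) (fun κ => gamMix g ε u κ β)
        (fun κ => gamMix g ε u κ ν)) u u := by
    rw [bil_bil_comm]; rfl
  rw [h, ← tr2_bil_gamMix hg hu]
  simp only [← quad_eq_bil]
  rfl

lemma tr2_gam (hg : GoodMetric g ginv) (hu : UnitVec g ε u) :
    tr2 ginv (gam g ε u) = n - 1 := by
  have hs := isSym2_gam hg.1 ε u
  have h : tr2 ginv (gam g ε u) = ∑ α, gamMix g ε u α α := by
    refine Finset.sum_congr rfl fun α _ => ?_
    rw [← hg.sum_ginv_mul_gam]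
    exact Finset.sum_congr rfl fun μ _ => by rw [hs]
  have h' : ∀ α, gamMix g ε u α α = 1 - ε * (u α * lower g u α) := by
    intro α; simp only [gamMix, if_true]; ring
  rw [h]
  simp only [h', Finset.sum_sub_distrib, ← Finset.mul_sum, hu.sum_mul_lower, hu.sq_eq_one]
  simp

lemma tr2_mul_gam (hg : GoodMetric g ginv) {A : Ten2 n}
    (h : ∀ ν, ∑ β, u β * A β ν = 0) (β ν : Fin n) :
    tr2 ginv (fun α μ => A α ν * gam g ε u μ β) = A β ν := by
  have h' : tr2 ginv (fun α μ => A α ν * gam g ε u μ β) = ∑ α, A α ν * gamMix g ε u α β := by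
    refine Finset.sum_congr rfl fun α _ => ?_
    rw [← hg.sum_ginv_mul_gam, Finset.mul_sum]
    exact Finset.sum_congr rfl fun μ _ => by ring
  have h'' : ∀ α, A α ν * gamMix g ε u α β =
      (if α = β then A α ν else 0) - ε * lower g u β * (u α * A α ν) := by
    intro α; simp only [gamMix]; split_ifs <;> ring
  rw [h']
  simp only [h'', Finset.sum_sub_distrib, ← Finset.mul_sum, h]
  simp

lemma ricT_kn_gam (hg : GoodMetric g ginv) (hu : UnitVec g ε u) {A : Ten2 n} (hA : IsSym2 A)
    (h : ∀ ν, ∑ β, u β * A β ν = 0) (β ν : Fin n) :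
    RicT ginv (KN A (gam g ε u)) β ν =
      tr2 ginv A * gam g ε u β ν + ((n : ℝ) - 3) * A β ν := by
  have hs := isSym2_gam hg.1 ε u
  have e : RicT ginv (KN A (gam g ε u)) β ν = tr2 ginv (fun α μ =>
      ((gam g ε u β ν * A α μ - A α ν * gam g ε u μ β) - A μ β * gam g ε u α ν) +
        A β ν * gam g ε u α μ) := by
    refine Finset.sum_congr rfl fun α _ => Finset.sum_congr rfl fun μ _ => ?_
    simp only [KN]
    rw [hs β μ, hA β μ]; ring
  have e₂ : tr2 ginv (fun α μ => A μ β * gam g ε u α ν) = A ν β := by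
    rw [← tr2_mul_gam (ε := ε) hg h ν β, ← tr2_swap hg.2.1]
  rw [e, tr2_add, tr2_sub, tr2_sub, tr2_const_mul, tr2_const_mul, tr2_gam hg hu,
    tr2_mul_gam hg h, e₂, hA ν β]
  ring

lemma ricT_parU (hn : 4 ≤ n) (hg : GoodMetric g ginv) (hu : UnitVec g ε u) {T : Ten4 n}
    (hT : IsRiemannType T) (β ν : Fin n) :
    RicT ginv (parU g ε u T) β ν =
      bil (RicT ginv T) (fun κ => gamMix g ε u κ β) (fun κ => gamMix g ε u κ ν) +
        ε / ((n : ℝ) - 3) * (bil (RicT ginv T) u u * gam g ε u β ν) := by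
  have hn' : (n : ℝ) - 3 ≠ 0 := by
    have : (4 : ℝ) ≤ n := by exact_mod_cast hn
    linarith
  have e : RicT ginv (parU g ε u T) β ν = RicT ginv (par4 g ε u T) β ν +
      ε / ((n : ℝ) - 3) * RicT ginv (KN (perp u T) (gam g ε u)) β ν :=
    (tr2_add _ _ _).trans (congrArg _ (tr2_const_mul _ _ _))
  rw [e, ricT_par4 hg hu hT, ricT_kn_gam hg hu (hT.isSym2_perp u) (hT.sum_perp u),
    hT.tr2_perp]
  field_simp
  ring

lemma ztr_eq (hT : IsRiemannType T) : Ztr ginv ε u T = bil (RicT ginv T) u u := by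
  have h : bil (perp u T) u u = 0 := by
    have : bil (perp u T) u u = quad T u u u u := by
      rw [quad_eq_bil, bil_bil_comm]; rfl
    linarith [hT.quad_swap_left u u u u]
  rw [← hT.tr2_perp]
  change tr2 (gamUp ginv ε u) _ = _
  rw [tr2_gamUp, h]
  ring

lemma vtr_eq (hg : GoodMetric g ginv) {T : Ten4 n} (hT : IsRiemannType T) (μ : Fin n) :
    Vtr g ginv ε u T μ = - bil (RicT ginv T) u (fun κ => gamMix g ε u κ μ) := by
  set p : Vec n := fun κ => gamMix g ε u κ μ with hp
  have hF : ∀ κ, ∑ α, u α * bil (fun ρ σ => T ρ α κ σ) u p = 0 := by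
    intro κ
    have : ∑ α, u α * bil (fun ρ σ => T ρ α κ σ) u p = quad T u u (Pi.single κ 1) p := by
      simp only [quad, bil, Finset.mul_sum, Pi.single_apply]
      rw [Finset.sum_comm]
      refine Finset.sum_congr rfl fun ρ _ => Finset.sum_congr rfl fun α _ => ?_
      rw [Finset.sum_comm]
      refine Finset.sum_congr rfl fun σ _ => ?_
      simp
      ring
    linarith [hT.quad_swap_left u u (Pi.single κ 1) p]
  have hpp : ∀ α β, perppar g ε u T α β μ = bil (fun ρ σ => T ρ α β σ) u p -
      ε * ((∑ κ, u κ * bil (fun ρ σ => T ρ α κ σ) u p) * lower g u β) := by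
    intro α β
    have e : perppar g ε u T α β μ =
        ∑ κ, gamMix g ε u κ β * bil (fun ρ σ => T ρ α κ σ) u p := by
      simp only [perppar, bil, Finset.mul_sum]
      rw [Finset.sum_comm]
      exact Finset.sum_congr rfl fun κ _ => Finset.sum_congr rfl fun ρ _ =>
        Finset.sum_congr rfl fun σ _ => by rw [hp]; ring
    have e' : ∀ κ, gamMix g ε u κ β * bil (fun ρ σ => T ρ α κ σ) u p =
        (if κ = β then bil (fun ρ σ => T ρ α κ σ) u p else 0) -
          ε * lower g u β * (u κ * bil (fun ρ σ => T ρ α κ σ) u p) := by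
      intro κ; simp only [gamMix]; split_ifs <;> ring
    rw [e]
    simp only [e', Finset.sum_sub_distrib, ← Finset.mul_sum]
    simp
    ring
  have hW : ∑ α, u α * ∑ κ, u κ * bil (fun ρ σ => T ρ α κ σ) u p = 0 := by
    simp only [Finset.mul_sum]
    rw [Finset.sum_comm]
    refine Finset.sum_eq_zero fun κ _ => ?_
    rw [← mul_zero (u κ), ← hF κ, Finset.mul_sum]
    exact Finset.sum_congr rfl fun _ _ => by ring
  have hbil : bil (fun α β => perppar g ε u T α β μ) u u = 0 := by
    unfold bil
    rw [Finset.sum_comm]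
    refine Finset.sum_eq_zero fun β _ => ?_
    have e : ∀ α, u α * u β * perppar g ε u T α β μ =
        u β * (u α * bil (fun ρ σ => T ρ α β σ) u p) - u β * ε * lower g u β *
          (u α * ∑ κ, u κ * bil (fun ρ σ => T ρ α κ σ) u p) := by
      intro α; rw [hpp]; ring
    simp only [e, Finset.sum_sub_distrib, ← Finset.mul_sum (Finset.univ), hF, hW]
    simp
  change tr2 (gamUp ginv ε u) (fun α β => perppar g ε u T α β μ) = _
  rw [tr2_gamUp, hbil]
  simp only [hpp]
  rw [tr2_sub, tr2_const_mul, tr2_mul_lower_right hg, hW, ← tr2_bil]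
  have e : (fun α β => bil (fun ρ σ => T ρ α β σ) u p) =
      fun α β => (-1) * bil (fun ρ σ => T α ρ β σ) u p := by
    ext α β
    simp only [bil, Finset.mul_sum]
    exact Finset.sum_congr rfl fun ρ _ => Finset.sum_congr rfl fun σ _ => by
      rw [hT.2.1]; ring
  rw [e, tr2_const_mul]
  ring

end Metric

lemma eq_zero_of_projections {g S : Ten2 n} {ε : ℝ} {u : Vec n} (hS : IsSym2 S)
    (huu : bil S u u = 0) (hup : ∀ μ, bil S u (fun κ => gamMix g ε u κ μ) = 0)
    (hpp : ∀ β ν, bil S (fun κ => gamMix g ε u κ β) (fun κ => gamMix g ε u κ ν) = 0)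
    (β ν : Fin n) : S β ν = 0 := by
  have hu : ∀ μ, bil S u (Pi.single μ 1) = 0 := by
    intro μ
    have := hup μ
    rw [gamMix_eq, bil_sub_smul_right, huu] at this
    linarith
  have := hpp β ν
  simp only [gamMix_eq, bil_sub_smul_left, bil_sub_smul_right, bil_single_single, hu, huu,
    bil_comm S hS (Pi.single β 1) u] at this
  linarith


/-- Lemma `decom1`, trace part: `T` is Weyl-type iff `T^{∥u}` is Weyl-type,
the trace `γ^{αβ} T^{⊥∥}_{αβμ}` vanishes and `tr_γ T^⊥ = 0`. -/
theorem stmt2 {n : ℕ} (hn : 4 ≤ n) (g ginv : Ten2 n) (hg : GoodMetric g ginv)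
    (ε : ℝ) (u : Vec n) (hu : UnitVec g ε u)
    (T : Ten4 n) (hT : IsRiemannType T) :
    IsWeylType ginv T ↔
      IsWeylType ginv (parU g ε u T) ∧ (∀ μ, Vtr g ginv ε u T μ = 0) ∧
        Ztr ginv ε u T = 0 := by
  have hsym := hT.isSym2_ricT hg.2.1
  simp only [vtr_eq hg hT, ztr_eq hT, neg_eq_zero]
  constructor
  · rintro ⟨-, hR⟩
    have hb : ∀ a b, bil (RicT ginv T) a b = 0 := fun a b => by simp [bil, hR]
    refine ⟨⟨hT.parU hg.1 ε u, fun β ν => ?_⟩, fun μ => hb _ _, hb _ _⟩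
    rw [ricT_parU hn hg hu hT, hb, hb]
    ring
  · rintro ⟨⟨-, hP⟩, hup, huu⟩
    refine ⟨hT, eq_zero_of_projections (g := g) (ε := ε) hsym huu hup fun β ν => ?_⟩
    have := hP β ν
    rw [ricT_parU hn hg hu hT, huu] at this
    linarith

end Decomp
end
end

section
/- Let A be a symmetric (0,2)-tensor on V. Then the components of the Riemann-type tensor A ∧ g with respect to u are given by: (A ∧ g)^⊥ = A^⊥ γ + ε A^∥; (A ∧ g)^{⊥∥}_{βμν} = A^{⊥∥}_μ γ_{νβ} − A^{⊥∥}_ν γ_{μβ}; and (A ∧ g)^{∥u} = (1/(n−3)) ((n−2) A^∥ + ε A^⊥ γ) ∧ γ; consequently A ∧ g = (A ∧ g)^{∥u} + ε (u ⊛ (A ∧ g)^{⊥∥}) + (A ∧ g)^⊥ ∧ η. -/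
open scoped BigOperators

noncomputable section

namespace Decomp

variable {n : ℕ}

/-- Contraction with the mixed projector removes the component along `u`. -/
lemma sum_gamMix_mul (g : Ten2 n) (ε : ℝ) (u : Vec n) (f : Vec n) (β : Fin n) :
    ∑ ρ, gamMix g ε u ρ β * f ρ = f β - ε * lower g u β * ∑ ρ, u ρ * f ρ := by
  simp only [gamMix, sub_mul, Finset.sum_sub_distrib, ite_mul, one_mul, zero_mul,
    Finset.sum_ite_eq', Finset.mem_univ, if_true, Finset.mul_sum]
  congr 1
  exact Finset.sum_congr rfl fun ρ _ => by ring

lemma sum_mul_eq_lower {S : Ten2 n} (hS : IsSym2 S) (u : Vec n) (β : Fin n) :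
    ∑ ρ, u ρ * S ρ β = lower S u β :=
  Finset.sum_congr rfl fun ρ _ => by rw [hS ρ β, mul_comm]

lemma sum_mul_lower (S : Ten2 n) (u : Vec n) :
    ∑ ρ, u ρ * lower S u ρ = s2perp u S := by
  simp only [lower, s2perp, Finset.mul_sum]
  exact Finset.sum_congr rfl fun ρ _ => Finset.sum_congr rfl fun κ _ => by ring

lemma s2perppar_eq (g : Ten2 n) (ε : ℝ) (u : Vec n) (S : Ten2 n) (β : Fin n) :
    s2perppar g ε u S β = lower S u β - ε * lower g u β * s2perp u S := by
  rw [← sum_mul_lower, ← sum_gamMix_mul]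
  simp only [s2perppar, lower, Finset.mul_sum]
  exact Finset.sum_congr rfl fun ρ _ => Finset.sum_congr rfl fun κ _ => by ring

lemma s2par_eq (g : Ten2 n) (ε : ℝ) (u : Vec n) {S : Ten2 n} (hS : IsSym2 S) (β ν : Fin n) :
    s2par g ε u S β ν = S β ν - ε * lower S u β * lower g u ν
      - ε * lower g u β * lower S u ν + ε ^ 2 * s2perp u S * lower g u β * lower g u ν := by
  have hrow : ∀ ρ, ∑ κ, gamMix g ε u κ ν * S ρ κ = S ρ ν - ε * lower g u ν * lower S u ρ :=
    fun ρ => by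
      rw [sum_gamMix_mul g ε u (S ρ)]
      simp only [lower, mul_comm]
  have hcomb : s2par g ε u S β ν
      = ∑ ρ, gamMix g ε u ρ β * (S ρ ν - ε * lower g u ν * lower S u ρ) := by
    simp only [s2par, mul_assoc, ← Finset.mul_sum, hrow]
  have hu : ∑ ρ, u ρ * (S ρ ν - ε * lower g u ν * lower S u ρ)
      = lower S u ν - ε * lower g u ν * s2perp u S := by
    rw [← sum_mul_eq_lower hS, ← sum_mul_lower, Finset.mul_sum, ← Finset.sum_sub_distrib]
    exact Finset.sum_congr rfl fun ρ _ => by ring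
  rw [hcomb, sum_gamMix_mul g ε u fun ρ => S ρ ν - ε * lower g u ν * lower S u ρ, hu]
  ring

lemma perp_KN (u : Vec n) {A B : Ten2 n} (hA : IsSym2 A) (hB : IsSym2 B) (β ν : Fin n) :
    perp u (KN A B) β ν = s2perp u A * B β ν - lower A u ν * lower B u β
      - lower A u β * lower B u ν + A β ν * s2perp u B := by
  rw [← sum_mul_eq_lower hA u ν, ← sum_mul_eq_lower hB u ν, mul_comm (lower A u β)]
  simp only [perp, KN, lower, s2perp, Finset.sum_mul_sum]
  simp only [Finset.mul_sum, Finset.sum_mul, ← Finset.sum_sub_distrib, ← Finset.sum_add_distrib]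
  exact Finset.sum_congr rfl fun ρ _ => Finset.sum_congr rfl fun κ _ => by ring

lemma perppar_KN (g : Ten2 n) (ε : ℝ) (u : Vec n) {A B : Ten2 n} (hA : IsSym2 A)
    (hB : IsSym2 B) (β μ ν : Fin n) :
    perppar g ε u (KN A B) β μ ν
      = s2perppar g ε u A μ * (∑ σ, gamMix g ε u σ ν * B β σ)
        - s2perppar g ε u A ν * (∑ κ, gamMix g ε u κ μ * B β κ)
        - (∑ κ, gamMix g ε u κ μ * A β κ) * s2perppar g ε u B ν
        + (∑ σ, gamMix g ε u σ ν * A β σ) * s2perppar g ε u B μ := by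
  have hpp : ∀ (S : Ten2 n), IsSym2 S → ∀ i,
      s2perppar g ε u S i = ∑ κ, gamMix g ε u κ i * ∑ α, u α * S α κ := fun S hS i => by
    simp only [s2perppar, Finset.mul_sum]
    exact Finset.sum_congr rfl fun ρ _ => Finset.sum_congr rfl fun κ _ => by
      rw [hS ρ κ]; ring
  rw [hpp A hA, hpp A hA, hpp B hB, hpp B hB,
    mul_comm (∑ κ, gamMix g ε u κ ν * ∑ α, u α * A α κ),
    mul_comm (∑ σ, gamMix g ε u σ ν * A β σ)]
  simp only [Finset.sum_mul_sum]
  rw [perppar, Finset.sum_comm]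
  simp only [← Finset.sum_sub_distrib, ← Finset.sum_add_distrib]
  refine Finset.sum_congr rfl fun κ _ => ?_
  rw [Finset.sum_comm]
  refine Finset.sum_congr rfl fun σ _ => ?_
  simp only [KN, Finset.mul_sum, Finset.sum_mul, ← Finset.sum_sub_distrib,
    ← Finset.sum_add_distrib]
  exact Finset.sum_congr rfl fun α _ => by ring

lemma par4_KN (g : Ten2 n) (ε : ℝ) (u : Vec n) (A B : Ten2 n) (α β μ ν : Fin n) :
    par4 g ε u (KN A B) α β μ ν = KN (s2par g ε u A) (s2par g ε u B) α β μ ν := by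
  have hdirect : ∀ (S T : Ten2 n) (i j k l : Fin n), s2par g ε u S i k * s2par g ε u T j l
      = ∑ ρ, ∑ σ, ∑ κ, ∑ δ, gamMix g ε u ρ i * gamMix g ε u σ j * gamMix g ε u κ k
          * gamMix g ε u δ l * (S ρ κ * T σ δ) := fun S T i j k l => by
    simp only [s2par, Finset.sum_mul_sum]
    refine Finset.sum_congr rfl fun ρ _ => Finset.sum_congr rfl fun σ _ =>
      Finset.sum_congr rfl fun κ _ => Finset.sum_congr rfl fun δ _ => by ring
  have hcross : ∀ S T : Ten2 n, s2par g ε u S α ν * s2par g ε u T β μ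
      = ∑ ρ, ∑ σ, ∑ κ, ∑ δ, gamMix g ε u ρ α * gamMix g ε u σ β * gamMix g ε u κ μ
          * gamMix g ε u δ ν * (S ρ δ * T σ κ) := fun S T => by
    rw [hdirect]
    refine Finset.sum_congr rfl fun ρ _ => Finset.sum_congr rfl fun σ _ => ?_
    rw [Finset.sum_comm]
    exact Finset.sum_congr rfl fun κ _ => Finset.sum_congr rfl fun δ _ => by ring
  rw [KN, mul_comm (s2par g ε u A β μ), mul_comm (s2par g ε u A β ν),
    hdirect A B α β μ ν, hdirect B A α β μ ν,
    hcross A B, hcross B A]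
  simp only [par4, KN, ← Finset.sum_sub_distrib, ← Finset.sum_add_distrib]
  exact Finset.sum_congr rfl fun ρ _ => Finset.sum_congr rfl fun σ _ =>
    Finset.sum_congr rfl fun κ _ => Finset.sum_congr rfl fun δ _ => by ring

/-- Corollary `decom3`: decomposition of `A ∧ g` with respect to `u`. -/
theorem stmt4 {n : ℕ} (hn : 4 ≤ n) (g ginv : Ten2 n) (hg : GoodMetric g ginv)
    (ε : ℝ) (u : Vec n) (hu : UnitVec g ε u)
    (A : Ten2 n) (hA : IsSym2 A) :
    (∀ β ν, perp u (KN A g) β ν =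
        s2perp u A * gam g ε u β ν + ε * s2par g ε u A β ν) ∧
    (∀ β μ ν, perppar g ε u (KN A g) β μ ν =
        s2perppar g ε u A μ * gam g ε u ν β - s2perppar g ε u A ν * gam g ε u μ β) ∧
    (∀ α β μ ν, parU g ε u (KN A g) α β μ ν =
        (1 / ((n : ℝ) - 3)) * KN
          (fun β' ν' => ((n : ℝ) - 2) * s2par g ε u A β' ν' + ε * s2perp u A * gam g ε u β' ν')
          (gam g ε u) α β μ ν) ∧
    (∀ α β μ ν, KN A g α β μ ν = parU g ε u (KN A g) α β μ ν
        + ε * circ (lower g u) (perppar g ε u (KN A g)) α β μ ν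
        + KN (perp u (KN A g)) (eta g ε u) α β μ ν) := by
  have hgs : IsSym2 g := hg.1
  have hε : ε ^ 2 = 1 := by rcases hu.1 with h | h <;> rw [h] <;> norm_num
  have hgu : s2perp u g = ε := by
    rw [← hu.2, s2perp]
    exact Finset.sum_congr rfl fun ρ _ => Finset.sum_congr rfl fun κ _ => by ring
  have hn3 : (n : ℝ) - 3 ≠ 0 := by
    have : (4 : ℝ) ≤ n := by exact_mod_cast hn
    linarith
  have hparg : s2par g ε u g = gam g ε u := by
    funext β ν
    rw [s2par_eq g ε u hgs, hgu, gam]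
    linear_combination (ε * lower g u β * lower g u ν) * hε
  have hppg : ∀ β, s2perppar g ε u g β = 0 := fun β => by
    rw [s2perppar_eq, hgu]
    linear_combination (-lower g u β) * hε
  have hmix : ∀ β ν, ∑ σ, gamMix g ε u σ ν * g β σ = gam g ε u ν β := fun β ν => by
    have hlow : ∑ σ, u σ * g β σ = lower g u β :=
      Finset.sum_congr rfl fun σ _ => mul_comm _ _
    rw [sum_gamMix_mul g ε u (g β), hlow, hgs β ν, gam]
  have hperp : ∀ β ν, perp u (KN A g) β ν =
      s2perp u A * gam g ε u β ν + ε * s2par g ε u A β ν := fun β ν => by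
    rw [perp_KN u hA hgs, s2par_eq g ε u hA, hgu, gam]
    linear_combination (lower A u β * lower g u ν + lower g u β * lower A u ν
      - ε * s2perp u A * lower g u β * lower g u ν) * hε
  have hperppar : ∀ β μ ν, perppar g ε u (KN A g) β μ ν =
      s2perppar g ε u A μ * gam g ε u ν β - s2perppar g ε u A ν * gam g ε u μ β :=
    fun β μ ν => by
      rw [perppar_KN g ε u hA hgs, hppg, hppg, hmix, hmix]
      ring
  refine ⟨hperp, hperppar, fun α β μ ν => ?_, fun α β μ ν => ?_⟩
  · rw [parU, par4_KN, hparg]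
    simp only [KN, hperp]
    field_simp
    grind
  · rw [parU, par4_KN, hparg]
    have hAeq : ∀ i j, A i j = s2par g ε u A i j + ε * lower g u i * s2perppar g ε u A j
        + ε * s2perppar g ε u A i * lower g u j + s2perp u A * lower g u i * lower g u j :=
      fun i j => by
        rw [s2par_eq g ε u hA, s2perppar_eq, s2perppar_eq]
        linear_combination (s2perp u A * lower g u i * lower g u j) * hε
    have hgeq : ∀ i j, g i j = gam g ε u i j + ε * lower g u i * lower g u j :=
      fun i j => by rw [gam]; ring
    have hgam : ∀ i j, gam g ε u i j = gam g ε u j i := fun i j => by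
      rw [gam, gam, hgs i j]; ring
    have hKN : KN A g α β μ ν
        = KN (fun i j => s2par g ε u A i j + ε * lower g u i * s2perppar g ε u A j
            + ε * s2perppar g ε u A i * lower g u j + s2perp u A * lower g u i * lower g u j)
          (fun i j => gam g ε u i j + ε * lower g u i * lower g u j) α β μ ν := by
      simp only [KN, ← hAeq, ← hgeq]
    rw [hKN]
    simp only [KN, hperp, circ, hperppar, eta]
    rw [hgam ν β, hgam μ β, hgam ν α, hgam μ α]
    ring

end Decomp
end
end
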